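/- For each t ∈ [0, 1] let φ̃_t(x, x̄) = (φ_t(x), x̄ + F_t(x)) be a homeomorphism of ℝ^{2n} × ℝ which preserves Lebesgue measure on ℝ^{2n+1} and is locally bi-Lipschitz with respect to the Carnot–Carathéodory distance d_CC on H(n). Suppose that the map Φ : H(n) × ℝ → H(n) × ℝ, Φ(p, t) = (φ̃_t(p), t), is locally Lipschitz with respect to the Carnot–Carathéodory distance of the Carnot group H(n) × ℝ. Then the curve is constant: φ̃_t = φ̃_0 for every t ∈ [0, 1]. -/

import Mathlib

open MeasureTheory Set Function
open scoped BigOperators Topology NNReal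

noncomputable section

/-- `ℝ^{2n}` with the Euclidean norm. -/
abbrev E (n : ℕ) := EuclideanSpace ℝ (Fin n ⊕ Fin n)

/-- The standard symplectic form `ω(x,y) = ⟨Jx, y⟩` on `ℝ^{2n}`. -/
def symp {n : ℕ} (x y : E n) : ℝ :=
  ∑ i : Fin n, (x (Sum.inl i) * y (Sum.inr i) - x (Sum.inr i) * y (Sum.inl i))

/-- The Heisenberg group `H(n) = ℝ^{2n} × ℝ` as a set. -/
abbrev Heis (n : ℕ) := E n × ℝ

/-- The a.e. horizontality condition on `[0,1]` for a curve `(c, cb)` in `H(n)`. -/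
def HorizOn {n : ℕ} (c : ℝ → E n) (cb : ℝ → ℝ) : Prop :=
  ∀ᵐ t ∂(volume.restrict (Icc (0:ℝ) 1)),
    HasDerivAt cb ((1/2) * symp (c t) (deriv c t)) t

/-- The Carnot–Carathéodory distance on `H(n)`. -/
def ccDist {n : ℕ} (p q : Heis n) : ℝ :=
  sInf { L : ℝ | ∃ (c : ℝ → E n) (cb : ℝ → ℝ) (K K' : ℝ≥0),
    LipschitzWith K c ∧ LipschitzWith K' cb ∧
    c 0 = p.1 ∧ cb 0 = p.2 ∧ c 1 = q.1 ∧ cb 1 = q.2 ∧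
    HorizOn c cb ∧
    L = ∫ t in Icc (0:ℝ) 1, ‖deriv c t‖ }

/-- The Carnot–Carathéodory distance on the Carnot group `H(n) × ℝ`, whose
horizontal curves are triples `(c, cb, s)` with `(c, cb)` horizontal in `H(n)`,
of length `∫ √(|c′|² + |s′|²)`. -/
def ccDist3 {n : ℕ} (p q : Heis n × ℝ) : ℝ :=
  sInf { L : ℝ | ∃ (c : ℝ → E n) (cb : ℝ → ℝ) (s : ℝ → ℝ) (K K' K'' : ℝ≥0),
    LipschitzWith K c ∧ LipschitzWith K' cb ∧ LipschitzWith K'' s ∧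
    c 0 = p.1.1 ∧ cb 0 = p.1.2 ∧ s 0 = p.2 ∧
    c 1 = q.1.1 ∧ cb 1 = q.1.2 ∧ s 1 = q.2 ∧
    HorizOn c cb ∧
    L = ∫ t in Icc (0:ℝ) 1, Real.sqrt (‖deriv c t‖^2 + (deriv s t)^2) }

/-- Local Lipschitz continuity of a map with respect to given distance functions. -/
def LocLipWith {X Y : Type*} (dX : X → X → ℝ) (dY : Y → Y → ℝ) (f : X → Y) : Prop :=
  ∀ p : X, ∃ r : ℝ, 0 < r ∧ ∃ K : ℝ, 0 ≤ K ∧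
    ∀ q q' : X, dX p q < r → dX p q' < r → dY (f q) (f q') ≤ K * dX q q'

open Filter Asymptotics

section Symplectic

variable {n : ℕ}

lemma symp_add_left (x y z : E n) : symp (x + y) z = symp x z + symp y z := by
  simp only [symp, PiLp.add_apply, ← Finset.sum_add_distrib]
  exact Finset.sum_congr rfl fun i _ => by ring

lemma symp_add_right (x y z : E n) : symp x (y + z) = symp x y + symp x z := by
  simp only [symp, PiLp.add_apply, ← Finset.sum_add_distrib]
  exact Finset.sum_congr rfl fun i _ => by ring

lemma symp_smul_left (r : ℝ) (x y : E n) : symp (r • x) y = r * symp x y := by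
  simp only [symp, PiLp.smul_apply, smul_eq_mul, Finset.mul_sum]
  exact Finset.sum_congr rfl fun i _ => by ring

lemma symp_smul_right (r : ℝ) (x y : E n) : symp x (r • y) = r * symp x y := by
  simp only [symp, PiLp.smul_apply, smul_eq_mul, Finset.mul_sum]
  exact Finset.sum_congr rfl fun i _ => by ring

lemma symp_self (x : E n) : symp x x = 0 :=
  Finset.sum_eq_zero fun i _ => by ring

lemma symp_swap (x y : E n) : symp x y = -symp y x := by
  simp only [symp, ← Finset.sum_neg_distrib]
  exact Finset.sum_congr rfl fun i _ => by ring

lemma symp_sub_right (x y z : E n) : symp x (y - z) = symp x y - symp x z := by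
  simp only [symp, PiLp.sub_apply, ← Finset.sum_sub_distrib]
  exact Finset.sum_congr rfl fun i _ => by ring

lemma symp_sub_left (x y z : E n) : symp (x - y) z = symp x z - symp y z := by
  simp only [symp, PiLp.sub_apply, ← Finset.sum_sub_distrib]
  exact Finset.sum_congr rfl fun i _ => by ring

lemma continuous_symp : Continuous fun p : E n × E n => symp p.1 p.2 := by
  unfold symp
  fun_prop

lemma symp_single_inr (x : E n) (i : Fin n) :
    symp x (EuclideanSpace.single (Sum.inr i) 1) = x (Sum.inl i) := by
  simp [symp]

lemma symp_single_inl (x : E n) (i : Fin n) :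
    symp x (EuclideanSpace.single (Sum.inl i) 1) = -x (Sum.inr i) := by
  simp [symp]

lemma eq_zero_of_symp_eq_zero {x : E n} (h : ∀ y, symp x y = 0) : x = 0 := by
  ext i
  rcases i with i | i
  · simpa [symp_single_inr] using h (EuclideanSpace.single (Sum.inr i) 1)
  · simpa [symp_single_inl] using h (EuclideanSpace.single (Sum.inl i) 1)

lemma abs_symp_le (x y : E n) : |symp x y| ≤ 2 * n * (‖x‖ * ‖y‖) := by
  have hc : ∀ i j : Fin n ⊕ Fin n, |x i * y j| ≤ ‖x‖ * ‖y‖ := fun i j => by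
    rw [abs_mul]
    exact mul_le_mul (PiLp.norm_apply_le x i) (PiLp.norm_apply_le y j) (abs_nonneg _)
      (norm_nonneg _)
  calc |symp x y| ≤ ∑ _i : Fin n, (‖x‖ * ‖y‖ + ‖x‖ * ‖y‖) :=
        (Finset.abs_sum_le_sum_abs _ _).trans <| Finset.sum_le_sum fun i _ =>
          (abs_sub _ _).trans (add_le_add (hc _ _) (hc _ _))
    _ = 2 * n * (‖x‖ * ‖y‖) := by
        rw [Finset.sum_const, Finset.card_univ, Fintype.card_fin, nsmul_eq_mul]
        ring

/-- A symplectic endomorphism is onto, so nothing but `0` is `symp`-orthogonal to its range. -/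
lemma eq_zero_of_symp_map_eq_zero (A : E n →ₗ[ℝ] E n) (hA : ∀ y z, symp (A y) (A z) = symp y z)
    {v : E n} (hv : ∀ y, symp (A y) v = 0) : v = 0 := by
  have hinj : Injective A := by
    refine (injective_iff_map_eq_zero A).2 fun y hy => eq_zero_of_symp_eq_zero fun z => ?_
    rw [← hA, hy]
    simp [symp]
  have hsurj := LinearMap.injective_iff_surjective.1 hinj
  refine eq_zero_of_symp_eq_zero fun w => ?_
  obtain ⟨y, rfl⟩ := hsurj w
  rw [symp_swap, hv, neg_zero]

end Symplectic

section Blowup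

variable {V W : Type*} [NormedAddCommGroup V] [NormedSpace ℝ V] [NormedAddCommGroup W]
  [NormedSpace ℝ W]

/-- If `G` is, up to a quadratic error, a primitive of `-B(h, dh)` for an alternating form `B`, then
`B` pulls back to zero under the derivative of `h` at every point of differentiability. -/
lemma bilin_fderiv_eq_zero (B : W →ₗ[ℝ] W →ₗ[ℝ] ℝ) (hB : ∀ w, B w w = 0)
    (hBc : Continuous fun p : W × W => B p.1 p.2) {h : V → W} {h' : V →L[ℝ] W} {G : V → ℝ} {z₀ : V}
    (hh : HasFDerivAt h h' z₀) {M : ℝ}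
    (hG : ∀ᶠ p : V × V in 𝓝 z₀ ×ˢ 𝓝 z₀,
      |G p.2 - G p.1 + B (h p.1) (h p.2)| ≤ M * ‖p.2 - p.1‖ ^ 2) (a b : V) :
    B (h' a) (h' b) = 0 := by
  have hswap : ∀ u w, B u w = -B w u := fun u w => by
    have := hB (u + w)
    simp only [map_add, LinearMap.add_apply, hB] at this
    linarith
  set s : ℝ → V → V → ℝ := fun ε a b =>
    ε⁻¹ ^ 2 * (G (z₀ + ε • b) - G (z₀ + ε • a) + B (h (z₀ + ε • a)) (h (z₀ + ε • b))) with hs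
  set k : ℝ → V → W := fun ε a => ε⁻¹ • (h (z₀ + ε • a) - h z₀) with hk
  have hklim : ∀ a, Tendsto (fun ε => k ε a) (𝓝[≠] 0) (𝓝 (h' a)) := fun a =>
    hh.hasLineDerivAt a |>.tendsto_slope_zero
  have hlim : ∀ a b, Tendsto (fun ε => B (k ε a) (k ε b)) (𝓝[≠] 0) (𝓝 (B (h' a) (h' b))) :=
    fun a b => (hBc.tendsto (h' a, h' b)).comp ((hklim a).prodMk_nhds (hklim b))
  have hthree : ∀ ε a m b, s ε a b = s ε a m + s ε m b +
      (B (k ε a) (k ε b) - B (k ε a) (k ε m) - B (k ε m) (k ε b)) := fun ε a m b => by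
    simp only [hs, hk, map_smul, map_sub, LinearMap.sub_apply, LinearMap.smul_apply, smul_eq_mul,
      hB]
    rw [hswap (h z₀) (h (z₀ + ε • b)), hswap (h z₀) (h (z₀ + ε • m))]
    ring
  have hzero : Tendsto (fun ε : ℝ => ε) (𝓝[≠] 0) (𝓝 0) := tendsto_id.mono_left nhdsWithin_le_nhds
  have hpt : ∀ a : V, Tendsto (fun ε : ℝ => z₀ + ε • a) (𝓝[≠] 0) (𝓝 z₀) := fun a => by
    simpa using tendsto_const_nhds (x := z₀) |>.add (hzero.smul_const a)
  have hbound : ∀ j : ℕ, ∀ a b, ∀ δ > 0, ∀ᶠ ε in 𝓝[≠] (0 : ℝ),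
      |s ε a b| ≤ M * ‖b - a‖ ^ 2 / 2 ^ j + δ := by
    intro j
    induction j with
    | zero =>
      intro a b δ hδ
      filter_upwards [((hpt a).prodMk (hpt b)).eventually hG, self_mem_nhdsWithin] with ε hε hne
      have hne : ε ≠ 0 := hne
      have hpos : 0 < ε⁻¹ ^ 2 := by positivity
      simp only [hs, abs_mul, abs_of_pos hpos, pow_zero, div_one]
      refine (mul_le_mul_of_nonneg_left hε hpos.le).trans ?_
      have : ‖z₀ + ε • b - (z₀ + ε • a)‖ = |ε| * ‖b - a‖ := by
        rw [add_sub_add_left_eq_sub, ← smul_sub, norm_smul, Real.norm_eq_abs]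
      rw [this, mul_pow, sq_abs]
      have : ε⁻¹ ^ 2 * (M * (ε ^ 2 * ‖b - a‖ ^ 2)) = M * ‖b - a‖ ^ 2 := by
        field_simp
      linarith
    | succ j ih =>
      intro a b δ hδ
      set m : V := (2⁻¹ : ℝ) • (a + b) with hm
      have hT : Tendsto (fun ε => B (k ε a) (k ε b) - B (k ε a) (k ε m) - B (k ε m) (k ε b))
          (𝓝[≠] 0) (𝓝 0) := by
        have := ((hlim a b).sub (hlim a m)).sub (hlim m b)
        convert this using 2
        simp only [hm, map_smul, map_add, LinearMap.add_apply, LinearMap.smul_apply, smul_eq_mul,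
          hB]
        ring
      have hma : ‖m - a‖ = 2⁻¹ * ‖b - a‖ := by
        rw [show m - a = (2⁻¹ : ℝ) • (b - a) by rw [hm]; module, norm_smul]
        norm_num
      have hbm : ‖b - m‖ = 2⁻¹ * ‖b - a‖ := by
        rw [show b - m = (2⁻¹ : ℝ) • (b - a) by rw [hm]; module, norm_smul]
        norm_num
      filter_upwards [ih a m (δ / 3) (by positivity), ih m b (δ / 3) (by positivity),
        (tendsto_zero_iff_abs_tendsto_zero _ |>.1 hT).eventually_lt_const
          (show (0 : ℝ) < δ / 3 by positivity)] with ε h₁ h₂ h₃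
      rw [hthree ε a m b]
      rw [hma] at h₁
      rw [hbm] at h₂
      have habs := (abs_add_le (s ε a m + s ε m b)
        (B (k ε a) (k ε b) - B (k ε a) (k ε m) - B (k ε m) (k ε b))).trans
          (add_le_add_left (abs_add_le _ _) _)
      have : M * (2⁻¹ * ‖b - a‖) ^ 2 / 2 ^ j + M * (2⁻¹ * ‖b - a‖) ^ 2 / 2 ^ j
          = M * ‖b - a‖ ^ 2 / 2 ^ (j + 1) := by
        rw [pow_succ (2 : ℝ) j]
        field_simp
        ring
      simp only [Function.comp] at h₃
      linarith
  have hslim : ∀ a b, Tendsto (fun ε => s ε a b) (𝓝[≠] 0) (𝓝 0) := by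
    intro a b
    rw [tendsto_zero_iff_abs_tendsto_zero]
    refine tendsto_order.2 ⟨fun c hc => .of_forall fun ε => hc.trans_le (abs_nonneg _),
      fun c hc => ?_⟩
    have hgeo : Tendsto (fun j : ℕ => M * ‖b - a‖ ^ 2 / (2 : ℝ) ^ j) atTop (𝓝 0) :=
      tendsto_const_nhds.div_atTop (tendsto_pow_atTop_atTop_of_one_lt (by norm_num))
    obtain ⟨j, hj⟩ := (hgeo.eventually_lt_const (half_pos hc)).exists
    filter_upwards [hbound j a b (c / 2) (by positivity)] with ε hε
    simp only [Function.comp]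
    linarith
  have h₁ := ((hslim a 0).add (hslim 0 b)).add
    (((hlim a b).sub (hlim a 0)).sub (hlim 0 b))
  have h₂ := tendsto_nhds_unique ((hslim a b).congr (hthree · a 0 b)) h₁
  simpa using h₂.symm

end Blowup

section CarnotCaratheodory

variable {n : ℕ}

/-- The set of lengths of horizontal curves of `H(n) × ℝ` joining `p` to `q`. -/
def horizLengths (p q : Heis n × ℝ) : Set ℝ :=
  { L : ℝ | ∃ (c : ℝ → E n) (cb : ℝ → ℝ) (s : ℝ → ℝ) (K K' K'' : ℝ≥0),
    LipschitzWith K c ∧ LipschitzWith K' cb ∧ LipschitzWith K'' s ∧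
    c 0 = p.1.1 ∧ cb 0 = p.1.2 ∧ s 0 = p.2 ∧
    c 1 = q.1.1 ∧ cb 1 = q.1.2 ∧ s 1 = q.2 ∧
    HorizOn c cb ∧
    L = ∫ t in Icc (0:ℝ) 1, Real.sqrt (‖deriv c t‖^2 + (deriv s t)^2) }

lemma LipschitzWith.sub_le_setIntegral {f g : ℝ → ℝ} {K : ℝ≥0} (hf : LipschitzWith K f)
    (hg : IntegrableOn g (Icc 0 1)) (hg₀ : ∀ s, 0 ≤ g s)
    (hfg : ∀ᵐ s ∂(volume.restrict (Icc (0:ℝ) 1)), deriv f s ≤ g s) {t : ℝ} (ht : t ∈ Icc (0:ℝ) 1) :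
    f t - f 0 ≤ ∫ s in Icc (0:ℝ) 1, g s := by
  have hac : AbsolutelyContinuousOnInterval f 0 t :=
    hf.lipschitzOnWith.absolutelyContinuousOnInterval
  have hsub : Icc 0 t ⊆ Icc (0:ℝ) 1 := Icc_subset_Icc_right ht.2
  have hgt : IntervalIntegrable g volume 0 t :=
    (intervalIntegrable_iff_integrableOn_Icc_of_le ht.1).2 (hg.mono_set hsub)
  calc f t - f 0 = ∫ s in (0:ℝ)..t, deriv f s := hac.integral_deriv_eq_sub.symm
    _ ≤ ∫ s in (0:ℝ)..t, g s :=
        intervalIntegral.integral_mono_ae_restrict ht.1 hac.intervalIntegrable_deriv hgt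
          (ae_mono (Measure.restrict_mono hsub le_rfl) hfg)
    _ = ∫ s in Icc (0:ℝ) t, g s := by
        rw [intervalIntegral.integral_of_le ht.1, integral_Icc_eq_integral_Ioc]
    _ ≤ ∫ s in Icc (0:ℝ) 1, g s :=
        setIntegral_mono_set hg (.of_forall hg₀) hsub.eventuallyLE

/-- A horizontal curve of length `L` moves by at most `L` horizontally, and by `O(L ^ 2)`
vertically. -/
lemma bounds_of_mem_horizLengths {p q : Heis n × ℝ} {L : ℝ} (hL : L ∈ horizLengths p q) :
    ‖q.1.1 - p.1.1‖ ≤ L ∧ |q.1.2 - p.1.2 - 1 / 2 * symp p.1.1 q.1.1| ≤ n * L ^ 2 := by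
  obtain ⟨c, cb, s, K, K', K'', hc, hcb, hs, hc0, hcb0, -, hc1, hcb1, -, hhor, rfl⟩ := hL
  rw [← hc0, ← hcb0, ← hc1, ← hcb1]
  set g : ℝ → ℝ := fun t => Real.sqrt (‖deriv c t‖ ^ 2 + (deriv s t) ^ 2) with hg
  set L := ∫ t in Icc (0:ℝ) 1, g t with hL
  have hg₀ : ∀ t, 0 ≤ g t := fun t => Real.sqrt_nonneg _
  have hcg : ∀ t, ‖deriv c t‖ ≤ g t := fun t =>
    Real.le_sqrt_of_sq_le (le_add_of_nonneg_right (sq_nonneg _))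
  have hgK : ∀ t, ‖g t‖ ≤ Real.sqrt ((K:ℝ) ^ 2 + (K'':ℝ) ^ 2) := fun t => by
    rw [Real.norm_of_nonneg (hg₀ t)]
    have h₁ : ‖deriv c t‖ ≤ K := norm_deriv_le_of_lipschitz hc
    have h₂ : |deriv s t| ≤ K'' := norm_deriv_le_of_lipschitz hs
    have h₃ : deriv s t ^ 2 ≤ (K'':ℝ) ^ 2 := by
      rw [← sq_abs]
      gcongr
    exact Real.sqrt_le_sqrt (by gcongr)
  have hgmeas : Measurable g := by
    have := measurable_deriv c
    have := measurable_deriv s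
    fun_prop
  have hgint : IntegrableOn g (Icc 0 1) :=
    Measure.integrableOn_of_bounded (by simp) hgmeas.aestronglyMeasurable (.of_forall hgK)
  have hL₀ : 0 ≤ L := integral_nonneg hg₀
  have hcdiff := hc.ae_differentiableAt_real
  have hdist : ∀ t ∈ Icc (0:ℝ) 1, ‖c t - c 0‖ ≤ L := by
    intro t ht
    set e := c t - c 0 with he
    have hlip : LipschitzWith (‖innerSL ℝ e‖₊ * K) fun r => inner ℝ e (c r) :=
      (innerSL ℝ e).lipschitz.comp hc
    have key := hlip.sub_le_setIntegral (g := fun r => ‖e‖ * g r) (hgint.const_mul _)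
      (fun r => mul_nonneg (norm_nonneg _) (hg₀ r)) (by
        filter_upwards [ae_restrict_of_ae hcdiff] with r hr
        have : HasDerivAt (fun r => inner ℝ e (c r)) (inner ℝ e (deriv c r)) r :=
          (innerSL ℝ e).hasFDerivAt.comp_hasDerivAt r hr.hasDerivAt
        rw [this.deriv]
        exact (real_inner_le_norm _ _).trans
          (mul_le_mul_of_nonneg_left (hcg r) (norm_nonneg _))) ht
    rw [← inner_sub_right, ← he, real_inner_self_eq_norm_sq, integral_const_mul, sq] at key
    rcases (norm_nonneg e).eq_or_lt with h | h
    · rwa [← h]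
    · exact le_of_mul_le_mul_left key h
  refine ⟨hdist 1 (by simp), ?_⟩
  have hlin : IsLinearMap ℝ fun y : E n => symp (c 0) y :=
    ⟨symp_add_right _, fun a => symp_smul_right a _⟩
  set Λ : E n →L[ℝ] ℝ := (1 / 2 : ℝ) • LinearMap.toContinuousLinearMap hlin.mk'
  have hΛ : ∀ y, Λ y = 1 / 2 * symp (c 0) y := fun y => rfl
  have hG : LipschitzWith (K' + ‖Λ‖₊ * K) fun r => cb r - 1 / 2 * symp (c 0) (c r) :=
    hcb.sub (Λ.lipschitz.comp hc)
  have hG' : LipschitzWith (K' + ‖Λ‖₊ * K) fun r => -(cb r - 1 / 2 * symp (c 0) (c r)) := hG.neg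
  have hderiv : ∀ᵐ r ∂(volume.restrict (Icc (0:ℝ) 1)),
      HasDerivAt (fun r => cb r - 1 / 2 * symp (c 0) (c r))
        (1 / 2 * symp (c r - c 0) (deriv c r)) r ∧
      |1 / 2 * symp (c r - c 0) (deriv c r)| ≤ n * L * g r := by
    filter_upwards [ae_restrict_of_ae hcdiff, hhor, ae_restrict_mem measurableSet_Icc]
      with r hr hcbr hrI
    refine ⟨?_, ?_⟩
    · refine (hcbr.sub (Λ.hasFDerivAt.comp_hasDerivAt r hr.hasDerivAt)).congr_deriv ?_
      rw [hΛ, symp_sub_left]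
      ring
    · have h₁ := abs_symp_le (c r - c 0) (deriv c r)
      have h₂ : ‖c r - c 0‖ * ‖deriv c r‖ ≤ L * g r :=
        mul_le_mul (hdist r hrI) (hcg r) (norm_nonneg _) hL₀
      have h₃ : (n:ℝ) * (‖c r - c 0‖ * ‖deriv c r‖) ≤ n * (L * g r) := by gcongr
      rw [abs_mul, abs_of_pos (by norm_num : (0:ℝ) < 1 / 2)]
      linarith
  have hint : ∫ r in Icc (0:ℝ) 1, n * L * g r = n * L ^ 2 := by
    rw [integral_const_mul, ← hL]
    ring
  have hnonneg : ∀ r, 0 ≤ n * L * g r := fun r =>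
    mul_nonneg (mul_nonneg n.cast_nonneg hL₀) (hg₀ r)
  have hup := hG.sub_le_setIntegral (hgint.const_mul (n * L)) hnonneg
    (hderiv.mono fun r hr => by
      rw [hr.1.deriv]
      exact (le_abs_self _).trans hr.2) (right_mem_Icc.2 zero_le_one)
  have hdown := hG'.sub_le_setIntegral (hgint.const_mul (n * L)) hnonneg
    (hderiv.mono fun r hr => by
      rw [hr.1.fun_neg.deriv]
      exact (neg_le_abs _).trans hr.2) (right_mem_Icc.2 zero_le_one)
  rw [hint, symp_self] at hup hdown
  rw [abs_le]
  constructor <;> linarith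

/-- A `C¹` horizontal curve on `[0, 1]` gives an admissible curve. -/
lemma exists_mem_horizLengths_of_contDiff {c : ℝ → E n} {cb s : ℝ → ℝ} (hc : ContDiff ℝ 1 c)
    (hcb : ContDiff ℝ 1 cb) (hs : ContDiff ℝ 1 s)
    (hhor : ∀ t, HasDerivAt cb (1 / 2 * symp (c t) (deriv c t)) t) {b : ℝ}
    (hb : ∀ t ∈ Icc (0:ℝ) 1, ‖deriv c t‖ + |deriv s t| ≤ b) :
    ∃ L ∈ horizLengths ((c 0, cb 0), s 0) ((c 1, cb 1), s 1), L ≤ b := by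
  set π : ℝ → ℝ := fun t => projIcc (0:ℝ) 1 zero_le_one t with hπ
  have hlip : ∀ {F : Type} [NormedAddCommGroup F] [NormedSpace ℝ F] (f : ℝ → F),
      ContDiff ℝ 1 f → ∃ K : ℝ≥0, LipschitzWith K fun t => f (π t) := by
    intro F _ _ f hf
    obtain ⟨K, hK⟩ := hf.contDiffOn.exists_lipschitzOnWith (s := Icc (0:ℝ) 1) one_ne_zero
      (convex_Icc 0 1) isCompact_Icc
    exact ⟨K * 1, (lipschitzOnWith_iff_restrict.1 hK).comp (LipschitzWith.projIcc zero_le_one)⟩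
  have hπid : ∀ t ∈ Ioo (0:ℝ) 1, π =ᶠ[𝓝 t] id := fun t ht => by
    filter_upwards [Ioo_mem_nhds ht.1 ht.2] with r hr
    simp [hπ, projIcc_of_mem zero_le_one (Ioo_subset_Icc_self hr)]
  have hloc : ∀ {F : Type} (f : ℝ → F), ∀ t ∈ Ioo (0:ℝ) 1, (fun r => f (π r)) =ᶠ[𝓝 t] f :=
    fun f t ht => (hπid t ht).mono fun r hr => by simp [hr]
  have hπ0 : π 0 = 0 := by simp [hπ]
  have hπ1 : π 1 = 1 := by simp [hπ]
  have hIoo : ∀ᵐ t ∂(volume.restrict (Icc (0:ℝ) 1)), t ∈ Ioo (0:ℝ) 1 := by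
    rw [← Measure.restrict_congr_set (Ioo_ae_eq_Icc (a := (0:ℝ)) (b := 1))]
    exact ae_restrict_mem measurableSet_Ioo
  obtain ⟨K, hK⟩ := hlip c hc
  obtain ⟨K', hK'⟩ := hlip cb hcb
  obtain ⟨K'', hK''⟩ := hlip s hs
  refine ⟨_, ⟨_, _, _, K, K', K'', hK, hK', hK'', by simp [hπ0], by simp [hπ0], by simp [hπ0],
    by simp [hπ1], by simp [hπ1], by simp [hπ1], ?_, rfl⟩, ?_⟩
  · filter_upwards [hIoo] with t ht
    rw [(hloc c t ht).deriv_eq, (hloc c t ht).eq_of_nhds]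
    exact (hhor t).congr_of_eventuallyEq (hloc cb t ht)
  · have hle : ∀ᵐ t ∂(volume.restrict (Icc (0:ℝ) 1)),
        ‖Real.sqrt (‖deriv (fun r => c (π r)) t‖ ^ 2 + (deriv (fun r => s (π r)) t) ^ 2)‖ ≤ b := by
      filter_upwards [hIoo] with t ht
      rw [(hloc c t ht).deriv_eq, (hloc s t ht).deriv_eq, Real.norm_of_nonneg (Real.sqrt_nonneg _)]
      refine le_trans (Real.sqrt_le_iff.2 ⟨by positivity, ?_⟩) (hb t (Ioo_subset_Icc_self ht))
      rw [← sq_abs (deriv s t)]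
      nlinarith [norm_nonneg (deriv c t), abs_nonneg (deriv s t)]
    have := norm_setIntegral_le_of_norm_le_const_ae (μ := volume) (by simp) hle
    simpa using (le_abs_self _).trans this

/-- Any two points of `H(n) × ℝ` are joined by a horizontal curve of controlled length: a straight
segment corrected by a loop enclosing the missing area. -/
lemma exists_mem_horizLengths_le (hn : 1 ≤ n) (p q : Heis n × ℝ) :
    ∃ L ∈ horizLengths p q, L ≤ 5000 * (‖q.1.1 - p.1.1‖ +
      Real.sqrt |q.1.2 - p.1.2 - 1 / 2 * symp p.1.1 q.1.1| + |q.2 - p.2|) := by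
  obtain ⟨⟨x, xb⟩, t₀⟩ := p
  obtain ⟨⟨y, yb⟩, t₁⟩ := q
  simp only
  set d := y - x with hd
  set τ := yb - xb - 1 / 2 * symp x y with hτ
  set ρ := Real.sqrt |τ| with hρ
  have hρ₀ : 0 ≤ ρ := Real.sqrt_nonneg _
  obtain ⟨σ, hσ, hσρ⟩ : ∃ σ : ℝ, |σ| ≤ ρ ∧ ρ * σ = τ := by
    have hsq : ρ * ρ = |τ| := Real.mul_self_sqrt (abs_nonneg _)
    rcases le_total 0 τ with h | h
    · exact ⟨ρ, (abs_of_nonneg hρ₀).le, by rw [hsq, abs_of_nonneg h]⟩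
    · exact ⟨-ρ, by rw [abs_neg, abs_of_nonneg hρ₀],
        by rw [mul_neg, hsq, abs_of_nonpos h, neg_neg]⟩
  set e : E n := EuclideanSpace.single (Sum.inl ⟨0, hn⟩) 1 with he
  set f : E n := EuclideanSpace.single (Sum.inr ⟨0, hn⟩) 1 with hf
  have hef : symp e f = 1 := by
    rw [hf, symp_single_inr, he]
    simp
  have hfe : symp f e = -1 := by rw [symp_swap, hef]
  have hne : ‖e‖ = 1 := by simp [he]
  have hnf : ‖f‖ = 1 := by simp [hf]
  set c : ℝ → E n := fun t => x + t • d + (70 * ρ * (t - 6 * t ^ 2 + 10 * t ^ 3 - 5 * t ^ 4)) • e +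
    (σ * (t - 3 * t ^ 2 + 2 * t ^ 3)) • f with hcdef
  set c' : ℝ → E n := fun t => d + (70 * ρ * (1 - 12 * t + 30 * t ^ 2 - 20 * t ^ 3)) • e +
    (σ * (1 - 6 * t + 6 * t ^ 2)) • f with hc'def
  set cb : ℝ → ℝ := fun t => xb + 1 / 2 * (t * symp x d +
    70 * ρ * (t - 6 * t ^ 2 + 10 * t ^ 3 - 5 * t ^ 4) * symp x e +
    σ * (t - 3 * t ^ 2 + 2 * t ^ 3) * symp x f +
    70 * ρ * (t * (t - 6 * t ^ 2 + 10 * t ^ 3 - 5 * t ^ 4) -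
      2 * (t ^ 2 / 2 - 2 * t ^ 3 + 5 / 2 * t ^ 4 - t ^ 5)) * symp d e +
    σ * (t * (t - 3 * t ^ 2 + 2 * t ^ 3) - 2 * (t ^ 2 / 2 - t ^ 3 + t ^ 4 / 2)) * symp d f +
    70 * (ρ * σ) * (t ^ 3 - 4 * t ^ 4 + 33 / 5 * t ^ 5 - 5 * t ^ 6 + 10 / 7 * t ^ 7)) with hcbdef
  have hpow : ∀ (k : ℕ) (t : ℝ), HasDerivAt (fun t : ℝ => t ^ k) (k * t ^ (k - 1)) t :=
    fun k t => hasDerivAt_pow k t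
  have hc' : ∀ t, HasDerivAt c (c' t) t := by
    intro t
    have ha : HasDerivAt (fun t : ℝ => 70 * ρ * (t - 6 * t ^ 2 + 10 * t ^ 3 - 5 * t ^ 4))
        (70 * ρ * (1 - 12 * t + 30 * t ^ 2 - 20 * t ^ 3)) t := by
      refine (((((hasDerivAt_id' t).sub ((hpow 2 t).const_mul 6)).add
        ((hpow 3 t).const_mul 10)).sub ((hpow 4 t).const_mul 5)).const_mul (70 * ρ)).congr_deriv ?_
      push_cast
      ring
    have hb : HasDerivAt (fun t : ℝ => σ * (t - 3 * t ^ 2 + 2 * t ^ 3))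
        (σ * (1 - 6 * t + 6 * t ^ 2)) t := by
      refine ((((hasDerivAt_id' t).sub ((hpow 2 t).const_mul 3)).add
        ((hpow 3 t).const_mul 2)).const_mul σ).congr_deriv ?_
      push_cast
      ring
    refine (((((hasDerivAt_id' t).smul_const d).const_add x).add (ha.smul_const e)).add
      (hb.smul_const f)).congr_deriv ?_
    simp [hc'def]
  have hhor : ∀ t, HasDerivAt cb (1 / 2 * symp (c t) (deriv c t)) t := by
    intro t
    rw [(hc' t).deriv]
    have hq : ∀ a₁ a₂ a₃ a₄ a₅ a₆ a₇ : ℝ, HasDerivAt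
        (fun t : ℝ => xb + (a₁ * t + a₂ * t ^ 2 + a₃ * t ^ 3 + a₄ * t ^ 4 + a₅ * t ^ 5 +
          a₆ * t ^ 6 + a₇ * t ^ 7))
        (a₁ + 2 * a₂ * t + 3 * a₃ * t ^ 2 + 4 * a₄ * t ^ 3 + 5 * a₅ * t ^ 4 + 6 * a₆ * t ^ 5 +
          7 * a₇ * t ^ 6) t := by
      intro a₁ a₂ a₃ a₄ a₅ a₆ a₇
      refine (((((((((hasDerivAt_id' t).const_mul a₁).add ((hpow 2 t).const_mul a₂)).add
        ((hpow 3 t).const_mul a₃)).add ((hpow 4 t).const_mul a₄)).add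
        ((hpow 5 t).const_mul a₅)).add ((hpow 6 t).const_mul a₆)).add
        ((hpow 7 t).const_mul a₇)).const_add xb).congr_deriv ?_
      push_cast
      ring
    convert hq (1 / 2 * (symp x d + 70 * ρ * symp x e + σ * symp x f))
      (1 / 2 * (-6 * 70 * ρ * symp x e - 3 * σ * symp x f))
      (1 / 2 * (10 * 70 * ρ * symp x e + 2 * σ * symp x f - 2 * 70 * ρ * symp d e - σ * symp d f
        + 70 * (ρ * σ)))
      (1 / 2 * (-5 * 70 * ρ * symp x e + 5 * 70 * ρ * symp d e + σ * symp d f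
        - 4 * 70 * (ρ * σ)))
      (1 / 2 * (-3 * 70 * ρ * symp d e + 33 / 5 * 70 * (ρ * σ)))
      (1 / 2 * (-5 * 70 * (ρ * σ))) (1 / 2 * (10 / 7 * 70 * (ρ * σ))) using 1
    · funext r
      simp only [hcbdef]
      ring
    · simp only [hcdef, hc'def, symp_add_left, symp_add_right, symp_smul_left, symp_smul_right,
        symp_self, hef, hfe]
      rw [symp_swap e d, symp_swap f d]
      ring
  have hs' : ∀ t, HasDerivAt (fun t : ℝ => t₀ + t * (t₁ - t₀)) (t₁ - t₀) t := fun t => by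
    simpa using ((hasDerivAt_id' t).mul_const (t₁ - t₀)).const_add t₀
  have hlen : ∀ t ∈ Icc (0:ℝ) 1,
      ‖deriv c t‖ + |deriv (fun t : ℝ => t₀ + t * (t₁ - t₀)) t| ≤
        5000 * (‖d‖ + ρ + |t₁ - t₀|) := by
    intro t ht
    rw [(hc' t).deriv, (hs' t).deriv]
    have ha : |70 * ρ * (1 - 12 * t + 30 * t ^ 2 - 20 * t ^ 3)| ≤ 70 * ρ * 63 := by
      rw [abs_mul, abs_of_nonneg (by positivity : 0 ≤ 70 * ρ)]
      refine mul_le_mul_of_nonneg_left ?_ (by positivity)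
      have h2 := pow_le_one₀ (n := 2) ht.1 ht.2
      have h3 := pow_le_one₀ (n := 3) ht.1 ht.2
      have h2' := pow_nonneg ht.1 2
      have h3' := pow_nonneg ht.1 3
      rw [abs_le]
      constructor <;> linarith [ht.1, ht.2]
    have hb : |σ * (1 - 6 * t + 6 * t ^ 2)| ≤ ρ * 13 := by
      rw [abs_mul]
      refine mul_le_mul hσ ?_ (abs_nonneg _) hρ₀
      have h2 := pow_le_one₀ (n := 2) ht.1 ht.2
      have h2' := pow_nonneg ht.1 2
      rw [abs_le]
      constructor <;> linarith [ht.1, ht.2]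
    have hc'n : ‖c' t‖ ≤ ‖d‖ + 70 * ρ * 63 + ρ * 13 := by
      refine (norm_add₃_le).trans ?_
      rw [norm_smul, norm_smul, hne, hnf, mul_one, mul_one, Real.norm_eq_abs, Real.norm_eq_abs]
      gcongr
    linarith [norm_nonneg d, abs_nonneg (t₁ - t₀)]
  obtain ⟨L, hL, hLle⟩ := exists_mem_horizLengths_of_contDiff (c := c) (cb := cb)
    (s := fun t => t₀ + t * (t₁ - t₀)) (by fun_prop) (by fun_prop) (by fun_prop) hhor hlen
  refine ⟨L, ?_, hLle⟩
  have hsxd : symp x d = symp x y := by rw [hd, symp_sub_right, symp_self, sub_zero]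
  have hc0 : c 0 = x := by simp [hcdef]
  have hc1 : c 1 = y := by
    simp only [hcdef, hd]
    norm_num
  have hcb0 : cb 0 = xb := by simp [hcbdef]
  have hcb1 : cb 1 = yb := by
    simp only [hcbdef, hsxd, hσρ, hτ]
    ring
  simpa [hc0, hc1, hcb0, hcb1] using hL

lemma ccDist3_le (hn : 1 ≤ n) (p q : Heis n × ℝ) :
    ccDist3 p q ≤ 5000 * (‖q.1.1 - p.1.1‖ +
      Real.sqrt |q.1.2 - p.1.2 - 1 / 2 * symp p.1.1 q.1.1| + |q.2 - p.2|) := by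
  obtain ⟨L, hL, hle⟩ := exists_mem_horizLengths_le hn p q
  refine le_trans (csInf_le ⟨0, ?_⟩ hL) hle
  exact fun L' hL' => (norm_nonneg _).trans (bounds_of_mem_horizLengths hL').1

lemma norm_sub_le_ccDist3 (hn : 1 ≤ n) (p q : Heis n × ℝ) : ‖q.1.1 - p.1.1‖ ≤ ccDist3 p q := by
  obtain ⟨L, hL, -⟩ := exists_mem_horizLengths_le hn p q
  exact le_csInf ⟨L, hL⟩ fun L' hL' => (bounds_of_mem_horizLengths hL').1

lemma abs_vertical_le_ccDist3_sq (hn : 1 ≤ n) (p q : Heis n × ℝ) :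
    |q.1.2 - p.1.2 - 1 / 2 * symp p.1.1 q.1.1| ≤ n * ccDist3 p q ^ 2 := by
  obtain ⟨L, hL, -⟩ := exists_mem_horizLengths_le hn p q
  have hn₀ : (0:ℝ) < n := by exact_mod_cast hn
  set D := |q.1.2 - p.1.2 - 1 / 2 * symp p.1.1 q.1.1|
  have h : Real.sqrt (D / n) ≤ ccDist3 p q := le_csInf ⟨L, hL⟩ fun L' hL' => by
    obtain ⟨h₁, h₂⟩ := bounds_of_mem_horizLengths hL'
    exact Real.sqrt_le_iff.2 ⟨(norm_nonneg _).trans h₁, (div_le_iff₀' hn₀).2 h₂⟩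
  exact (div_le_iff₀' hn₀).1 (Real.sqrt_le_iff.1 h).2

end CarnotCaratheodory

/-- *Rademacher's theorem* for locally Lipschitz functions. -/
lemma LocallyLipschitz.ae_differentiableAt {V W : Type*} [NormedAddCommGroup V] [NormedSpace ℝ V]
    [FiniteDimensional ℝ V] [MeasurableSpace V] [BorelSpace V] [NormedAddCommGroup W]
    [NormedSpace ℝ W] [FiniteDimensional ℝ W] (μ : Measure V) [μ.IsAddHaarMeasure] {f : V → W}
    (hf : LocallyLipschitz f) : ∀ᵐ x ∂μ, DifferentiableAt ℝ f x := by
  have hloc : ∀ x, ∃ U ∈ 𝓝 x, ∀ᵐ y ∂μ, y ∈ U → DifferentiableAt ℝ f y := by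
    intro x
    obtain ⟨K, U, hU, hK⟩ := hf x
    obtain ⟨O, hOU, hO, hxO⟩ := mem_nhds_iff.1 hU
    refine ⟨O, hO.mem_nhds hxO, ?_⟩
    filter_upwards [(hK.mono hOU).ae_differentiableWithinAt_of_mem (μ := μ)] with y hy hyO
    exact (hy hyO).differentiableAt (hO.mem_nhds hyO)
  choose U hU hae using hloc
  obtain ⟨s, hs, hcover⟩ := TopologicalSpace.countable_cover_nhds hU
  filter_upwards [(ae_ball_iff hs).2 fun x _ => hae x] with y hy
  obtain ⟨x, hx, hyx⟩ := mem_iUnion₂.1 (hcover.ge (mem_univ y))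
  exact hy x hx hyx

/-- A locally Lipschitz function of a real variable with almost everywhere vanishing derivative is
constant. -/
lemma LocallyLipschitz.eq_of_ae_hasDerivAt_zero {W : Type*} [NormedAddCommGroup W]
    [NormedSpace ℝ W] {f : ℝ → W} (hf : LocallyLipschitz f)
    (hae : ∀ᵐ s : ℝ, HasDerivAt f 0 s) (t t' : ℝ) : f t = f t' := by
  obtain ⟨K, hK⟩ := hf.locallyLipschitzOn.exists_lipschitzOnWith_of_compact
    (isCompact_uIcc (a := t) (b := t'))
  obtain ⟨C, hC⟩ := hK.absolutelyContinuousOnInterval.const_of_ae_hasDerivAt_zero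
    (hae.mono fun s hs _ => hs)
  exact (hC t left_mem_uIcc).trans (hC t' right_mem_uIcc).symm

/-- A locally Lipschitz flow with almost everywhere vanishing time derivative is constant. -/
lemma LocallyLipschitz.flow_eq_of_ae_hasDerivAt_zero {V W : Type*} [NormedAddCommGroup V]
    [MeasureSpace V] [SFinite (volume : Measure V)] [(volume : Measure V).IsOpenPosMeasure]
    [NormedAddCommGroup W] [NormedSpace ℝ W] {φ : ℝ → V → W}
    (hloc : LocallyLipschitz fun z : V × ℝ => φ z.2 z.1)
    (hae : ∀ᵐ z : V × ℝ, HasDerivAt (fun s => φ s z.1) 0 z.2) (t t' : ℝ) : φ t = φ t' := by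
  have hcont : ∀ s : ℝ, Continuous fun x => φ s x := fun s =>
    hloc.continuous.comp (f := fun x : V => (x, s)) (by fun_prop)
  have hae' : ∀ᵐ x : V, ∀ᵐ s : ℝ, HasDerivAt (fun s => φ s x) 0 s :=
    Measure.ae_ae_of_ae_prod hae
  refine ((hcont t).ae_eq_iff_eq volume (hcont t')).1 ?_
  filter_upwards [hae'] with x hx
  have hincl : LocallyLipschitz fun s : ℝ => (x, s) :=
    (LipschitzWith.prodMk_left x).locallyLipschitz
  exact (hloc.comp hincl).eq_of_ae_hasDerivAt_zero hx t t'

section Flow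

variable {n : ℕ} {φ : ℝ → E n → E n} {F : ℝ → E n → ℝ}

/-- Local Lipschitz continuity of `Φ` for the Carnot–Carathéodory distance, in Euclidean terms. -/
lemma eventually_bounds_of_locLipWith (hn : 1 ≤ n)
    (hPhi : LocLipWith ccDist3 ccDist3
      (fun pt : Heis n × ℝ => (((φ pt.2 pt.1.1, pt.1.2 + F pt.2 pt.1.1) : Heis n), pt.2)))
    (z₀ : E n × ℝ) :
    ∃ M : ℝ, 0 ≤ M ∧ ∀ᶠ p : (E n × ℝ) × (E n × ℝ) in 𝓝 z₀ ×ˢ 𝓝 z₀,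
      ‖φ p.2.2 p.2.1 - φ p.1.2 p.1.1‖ ≤ M * ‖p.2 - p.1‖ ∧
      |F p.2.2 p.2.1 - F p.1.2 p.1.1 + (1 / 2 * symp p.1.1 p.2.1 -
        1 / 2 * symp (φ p.1.2 p.1.1) (φ p.2.2 p.2.1))| ≤ n * (M * ‖p.2 - p.1‖) ^ 2 := by
  obtain ⟨r, hr, K, hK, hlip⟩ := hPhi ((z₀.1, 0), z₀.2)
  have hsymp : ∀ {f g : (E n × ℝ) × (E n × ℝ) → E n}, Continuous f → Continuous g →
      Continuous fun p => symp (f p) (g p) :=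
    fun hf hg => continuous_symp.comp (hf.prodMk hg)
  have hnear₁ : ∀ᶠ p : (E n × ℝ) × (E n × ℝ) in 𝓝 (z₀, z₀),
      5000 * (‖p.1.1 - z₀.1‖ + Real.sqrt |0 - 0 - 1 / 2 * symp z₀.1 p.1.1| + |p.1.2 - z₀.2|) < r := by
    have hcont := hsymp (f := fun _ => z₀.1) (g := fun p => p.1.1) (by fun_prop) (by fun_prop)
    refine ContinuousAt.eventually_lt (by fun_prop) continuousAt_const ?_
    simpa [symp_self] using hr
  have hnear₂ : ∀ᶠ p : (E n × ℝ) × (E n × ℝ) in 𝓝 (z₀, z₀),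
      5000 * (‖p.2.1 - z₀.1‖ +
        Real.sqrt |1 / 2 * symp p.1.1 p.2.1 - 0 - 1 / 2 * symp z₀.1 p.2.1| + |p.2.2 - z₀.2|) < r := by
    have hcont := hsymp (f := fun _ => z₀.1) (g := fun p => p.2.1) (by fun_prop) (by fun_prop)
    have hcont' := hsymp (f := fun p => p.1.1) (g := fun p => p.2.1) (by fun_prop) (by fun_prop)
    refine ContinuousAt.eventually_lt (by fun_prop) continuousAt_const ?_
    simpa [symp_self] using hr
  refine ⟨K * 10000, by positivity, ?_⟩
  rw [← nhds_prod_eq]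
  filter_upwards [hnear₁, hnear₂] with ⟨z, z'⟩ h₁ h₂
  have hq : ccDist3 ((z₀.1, 0), z₀.2) ((z.1, 0), z.2) < r := (ccDist3_le hn _ _).trans_lt h₁
  have hq' : ccDist3 ((z₀.1, 0), z₀.2) ((z'.1, 1 / 2 * symp z.1 z'.1), z'.2) < r :=
    (ccDist3_le hn _ _).trans_lt h₂
  have hdom : ccDist3 ((z.1, 0), z.2) ((z'.1, 1 / 2 * symp z.1 z'.1), z'.2) ≤
      10000 * ‖z' - z‖ := by
    refine (ccDist3_le hn _ _).trans ?_
    simp only [sub_zero, sub_self, abs_zero, Real.sqrt_zero, add_zero]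
    have h₃ : ‖z'.1 - z.1‖ ≤ ‖z' - z‖ := norm_fst_le (z' - z)
    have h₄ : |z'.2 - z.2| ≤ ‖z' - z‖ := norm_snd_le (z' - z)
    linarith
  set P : Heis n × ℝ := ((φ z.2 z.1, 0 + F z.2 z.1), z.2) with hP
  set Q : Heis n × ℝ := ((φ z'.2 z'.1, 1 / 2 * symp z.1 z'.1 + F z'.2 z'.1), z'.2) with hQ
  have himg : ccDist3 P Q ≤ K * 10000 * ‖z' - z‖ := by
    have h := hlip ((z.1, 0), z.2) ((z'.1, 1 / 2 * symp z.1 z'.1), z'.2) hq hq'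
    rw [mul_assoc]
    exact h.trans (mul_le_mul_of_nonneg_left hdom hK)
  have hhor := norm_sub_le_ccDist3 hn P Q
  refine ⟨hhor.trans himg, ?_⟩
  refine le_trans (le_of_eq ?_) ((abs_vertical_le_ccDist3_sq hn P Q).trans
    (mul_le_mul_of_nonneg_left (pow_le_pow_left₀ ((norm_nonneg _).trans hhor) himg 2)
      n.cast_nonneg))
  simp only [hP, hQ]
  congr 1
  ring

/-- The form `(ω ⊕ -ω) / 2` on `ℝ^{2n} × ℝ^{2n}`. -/
def sympDiff (n : ℕ) : (E n × E n) →ₗ[ℝ] (E n × E n) →ₗ[ℝ] ℝ :=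
  LinearMap.mk₂ ℝ (fun u w => 1 / 2 * symp u.1 w.1 - 1 / 2 * symp u.2 w.2)
    (fun u v w => by simp only [Prod.fst_add, Prod.snd_add, symp_add_left]; ring)
    (fun a u w => by simp only [Prod.smul_fst, Prod.smul_snd, symp_smul_left, smul_eq_mul]; ring)
    (fun u v w => by simp only [Prod.fst_add, Prod.snd_add, symp_add_right]; ring)
    (fun a u w => by simp only [Prod.smul_fst, Prod.smul_snd, symp_smul_right, smul_eq_mul]; ring)

lemma sympDiff_apply (u w : E n × E n) :
    sympDiff n u w = 1 / 2 * symp u.1 w.1 - 1 / 2 * symp u.2 w.2 := rfl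

/-- Where `(x, t) ↦ φ_t(x)` is differentiable, its time derivative vanishes. -/
lemma fderiv_time_eq_zero {z₀ : E n × ℝ} {M : ℝ}
    (hM : ∀ᶠ p : (E n × ℝ) × (E n × ℝ) in 𝓝 z₀ ×ˢ 𝓝 z₀,
      |F p.2.2 p.2.1 - F p.1.2 p.1.1 + (1 / 2 * symp p.1.1 p.2.1 -
        1 / 2 * symp (φ p.1.2 p.1.1) (φ p.2.2 p.2.1))| ≤ M * ‖p.2 - p.1‖ ^ 2)
    {A : E n × ℝ →L[ℝ] E n} (hA : HasFDerivAt (fun z : E n × ℝ => φ z.2 z.1) A z₀) :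
    A (0, 1) = 0 := by
  have hcont : Continuous fun p : (E n × E n) × (E n × E n) => sympDiff n p.1 p.2 := by
    simp only [sympDiff_apply]
    have h₁ := continuous_symp.comp (f := fun p : (E n × E n) × (E n × E n) => (p.1.1, p.2.1))
      (by fun_prop)
    have h₂ := continuous_symp.comp (f := fun p : (E n × E n) × (E n × E n) => (p.1.2, p.2.2))
      (by fun_prop)
    exact (continuous_const.mul h₁).sub (continuous_const.mul h₂)
  have key : ∀ a b : E n × ℝ, symp (A a) (A b) = symp a.1 b.1 := fun a b => by
    have := bilin_fderiv_eq_zero (sympDiff n) (fun w => by simp [sympDiff_apply, symp_self])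
      hcont (h := fun z : E n × ℝ => (z.1, φ z.2 z.1)) (G := fun z => F z.2 z.1)
      (hasFDerivAt_fst.prodMk hA) hM a b
    simp only [sympDiff_apply, ContinuousLinearMap.prod_apply, ContinuousLinearMap.coe_fst'] at this
    linarith
  refine eq_zero_of_symp_map_eq_zero (A.toLinearMap ∘ₗ LinearMap.inl ℝ (E n) ℝ)
    (fun y z => key (y, 0) (z, 0)) fun y => (key (y, 0) (0, 1)).trans ?_
  simp [symp]

lemma locallyLipschitz_of_locLipWith (hn : 1 ≤ n)
    (hPhi : LocLipWith ccDist3 ccDist3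
      (fun pt : Heis n × ℝ => (((φ pt.2 pt.1.1, pt.1.2 + F pt.2 pt.1.1) : Heis n), pt.2))) :
    LocallyLipschitz fun z : E n × ℝ => φ z.2 z.1 := by
  intro z₀
  obtain ⟨M, hM, hev⟩ := eventually_bounds_of_locLipWith hn hPhi z₀
  obtain ⟨U, hU, hUU⟩ := mem_prod_self_iff.1 hev
  refine ⟨⟨M, hM⟩, U, hU, LipschitzOnWith.of_dist_le_mul fun z hz z' hz' => ?_⟩
  rw [dist_eq_norm, dist_eq_norm]
  exact (hUU (mk_mem_prod hz' hz)).1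

lemma horizontal_eq_of_locLipWith (hn : 1 ≤ n)
    (hPhi : LocLipWith ccDist3 ccDist3
      (fun pt : Heis n × ℝ => (((φ pt.2 pt.1.1, pt.1.2 + F pt.2 pt.1.1) : Heis n), pt.2)))
    (t : ℝ) : φ t = φ 0 := by
  have hloc := locallyLipschitz_of_locLipWith hn hPhi
  have hhaar : (volume : Measure (E n × ℝ)).IsAddHaarMeasure :=
    Measure.prod.instIsAddHaarMeasure volume volume
  refine hloc.flow_eq_of_ae_hasDerivAt_zero ?_ t 0
  filter_upwards [hloc.ae_differentiableAt volume] with z hz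
  obtain ⟨M, -, hev⟩ := eventually_bounds_of_locLipWith hn hPhi z
  have hzero := fderiv_time_eq_zero (M := n * M ^ 2)
    (hev.mono fun p hp => hp.2.trans_eq (by ring)) hz.hasFDerivAt
  have hpath : HasDerivAt (fun s : ℝ => (z.1, s)) ((0 : E n), (1 : ℝ)) z.2 :=
    (hasDerivAt_const z.2 z.1).prodMk (hasDerivAt_id' z.2)
  have hcomp := HasFDerivAt.comp_hasDerivAt (l := fun z : E n × ℝ => φ z.2 z.1) z.2
    hz.hasFDerivAt hpath
  exact hcomp.congr_deriv hzero

/-- If `φ_t` does not depend on `t`, the quadratic bound on `F` forces `F_t` not to depend on `t`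
either. -/
lemma vertical_eq_of_locLipWith (hn : 1 ≤ n)
    (hPhi : LocLipWith ccDist3 ccDist3
      (fun pt : Heis n × ℝ => (((φ pt.2 pt.1.1, pt.1.2 + F pt.2 pt.1.1) : Heis n), pt.2)))
    (hφ : ∀ t, φ t = φ 0) (x : E n) (t : ℝ) : F t x = F 0 x := by
  have hderiv : ∀ s : ℝ, HasDerivAt (fun s => F s x) 0 s := by
    intro s
    obtain ⟨M, -, hev⟩ := eventually_bounds_of_locLipWith hn hPhi (x, s)
    have hpath : Tendsto (fun s' : ℝ => (x, s')) (𝓝 s) (𝓝 (x, s)) :=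
      Continuous.tendsto (by fun_prop) s
    have hpair : Tendsto (fun s' : ℝ => ((x, s), (x, s'))) (𝓝 s) (𝓝 (x, s) ×ˢ 𝓝 (x, s)) :=
      tendsto_const_nhds.prodMk hpath
    have hO : (fun s' => F s' x - F s x) =O[𝓝 s] fun s' => ‖s' - s‖ ^ 2 := by
      refine IsBigO.of_bound (n * M ^ 2) ?_
      filter_upwards [hpair.eventually hev] with s' hs'
      have h := hs'.2
      simp only [hφ s', hφ s, symp_self, Prod.mk_sub_mk, sub_self,
        Prod.norm_mk, norm_zero, max_eq_right (norm_nonneg (s' - s))] at h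
      rw [norm_pow, norm_norm, Real.norm_eq_abs (F s' x - F s x)]
      simpa [mul_pow, mul_assoc] using h
    rw [hasDerivAt_iff_isLittleO]
    simpa using hO.trans_isLittleO (isLittleO_pow_sub_sub s one_lt_two)
  exact is_const_of_deriv_eq_zero (fun s => (hderiv s).differentiableAt)
    (fun s => (hderiv s).deriv) t 0

end Flow

/-- There is no nonconstant curve `t ↦ φ̃_t` of volume preserving locally bi-Lipschitz
homeomorphisms of `H(n)` such that `(p, t) ↦ (φ̃_t(p), t)` is locally Lipschitz for
the Carnot–Carathéodory distance of `H(n) × ℝ`. -/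
theorem no_nonconstant_Lipschitz_flows_of_biLipschitz_homeomorphisms
    (n : ℕ) (hn : 1 ≤ n) (φ : ℝ → E n → E n) (F : ℝ → E n → ℝ)
    (hhomeo : ∀ t ∈ Icc (0:ℝ) 1,
      IsHomeomorph (fun p : Heis n => ((φ t p.1, p.2 + F t p.1) : Heis n)))
    (hvol : ∀ t ∈ Icc (0:ℝ) 1,
      MeasurePreserving (fun p : Heis n => ((φ t p.1, p.2 + F t p.1) : Heis n))
        volume volume)
    (hlip : ∀ t ∈ Icc (0:ℝ) 1,
      LocLipWith ccDist ccDist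
        (fun p : Heis n => ((φ t p.1, p.2 + F t p.1) : Heis n)))
    (hlipinv : ∀ t ∈ Icc (0:ℝ) 1,
      ∃ g : Heis n → Heis n,
        Function.LeftInverse g (fun p : Heis n => ((φ t p.1, p.2 + F t p.1) : Heis n)) ∧
        Function.RightInverse g (fun p : Heis n => ((φ t p.1, p.2 + F t p.1) : Heis n)) ∧
        LocLipWith ccDist ccDist g)
    (hPhi : LocLipWith ccDist3 ccDist3
      (fun pt : Heis n × ℝ =>
        (((φ pt.2 pt.1.1, pt.1.2 + F pt.2 pt.1.1) : Heis n), pt.2))) :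
    ∀ t ∈ Icc (0:ℝ) 1, ∀ p : Heis n,
      ((φ t p.1, p.2 + F t p.1) : Heis n) = (φ 0 p.1, p.2 + F 0 p.1) := by
  have hφ := horizontal_eq_of_locLipWith hn hPhi
  intro t _ p
  rw [hφ t, vertical_eq_of_locLipWith hn hPhi hφ p.1 t]
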